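/- If in some schedule on m machines the total weighted count Σ_p n_p·w(p) exceeds m, where medium jobs have weight 1/2 and size > p_small·B, and big jobs have weight 1 and size > p_big·B, then some machine has load strictly greater than (2/c)·B, where c = (1+√13)/3, p_small = c−1, p_big = c/2. Specifically, some machine contains either three medium jobs (load > 3(c−1)B > (2/c)B) or a big job plus another critical job (load > (p_small + p_big)B = (3c/2 − 1)B = (2/c)B). Hence OPT ≥ (2/c)·B. -/

import Mathlib

/-- A set of jobs of weight `1 / 2` (size `> p`) or `1` (size `> q`) whose total weight exceeds `1`
contains three jobs or a job of weight `1` together with another job, so its load exceeds every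
`T ≤ min (p + q) (3 * p)`. -/
theorem lt_sum_size_of_one_lt_sum_weight {ι : Type*} (S : Finset ι) (w s : ι → ℝ) {p q T : ℝ}
    (hp : 0 ≤ p) (hpq : p ≤ q) (hT : T ≤ p + q) (hT' : T ≤ 3 * p)
    (hw : ∀ i, w i = 1 / 2 ∨ w i = 1) (hmed : ∀ i, w i = 1 / 2 → p < s i)
    (hbig : ∀ i, w i = 1 → q < s i) (hsum : 1 < ∑ i ∈ S, w i) :
    T < ∑ i ∈ S, s i := by
  classical
  have hps : ∀ i, p < s i := fun i =>
    (hw i).elim (hmed i) fun h => hpq.trans_lt (hbig i h)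
  by_cases hb : ∃ b ∈ S, w b = 1
  · obtain ⟨b, hbS, hwb⟩ := hb
    rw [← Finset.add_sum_erase S w hbS, hwb] at hsum
    have hne : (S.erase b).Nonempty := by
      by_contra h
      simp [Finset.not_nonempty_iff_eq_empty.mp h] at hsum
    obtain ⟨j, hj⟩ := hne
    have hle : s j ≤ ∑ i ∈ S.erase b, s i :=
      Finset.single_le_sum (fun i _ => hp.trans (hps i).le) hj
    rw [← Finset.add_sum_erase S s hbS]
    linarith [hbig b hwb, hps j]
  · push Not at hb
    have hcard : ∑ i ∈ S, w i = S.card * (1 / 2) := by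
      rw [Finset.sum_congr rfl fun i hi => (hw i).resolve_right (hb i hi), Finset.sum_const,
        nsmul_eq_mul]
    have hthree : 3 ≤ S.card := by
      have : (2 : ℝ) < S.card := by linarith
      exact_mod_cast this
    have hthree' : (3 : ℝ) ≤ S.card := by exact_mod_cast hthree
    have hlt : ∑ _i ∈ S, p < ∑ i ∈ S, s i :=
      Finset.sum_lt_sum_of_nonempty (Finset.card_pos.mp (by omega)) fun i _ => hps i
    rw [Finset.sum_const, nsmul_eq_mul] at hlt
    nlinarith [mul_le_mul_of_nonneg_right hthree' hp]

/-- If the total weighted count of critical jobs exceeds m (medium jobs weigh 1/2 and have size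
> p_small·B = (c−1)·B, big jobs weigh 1 and have size > p_big·B = (c/2)·B, c = (1+√13)/3),
then in any schedule some machine has load strictly greater than (2/c)·B; hence OPT ≥ (2/c)·B. -/
theorem stmt16 (m : ℕ) (hm : 0 < m) (B : ℝ) (hB : 0 < B)
    {ι : Type*} [Fintype ι] (w s : ι → ℝ) (hs : ∀ i, 0 ≤ s i)
    (hw : ∀ i, w i = 1 / 2 ∨ w i = 1)
    (hmed : ∀ i, w i = 1 / 2 → ((1 + Real.sqrt 13) / 3 - 1) * B < s i)
    (hbig : ∀ i, w i = 1 → ((1 + Real.sqrt 13) / 3 / 2) * B < s i)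
    (a : ι → Fin m)
    (htot : (m : ℝ) < ∑ i, w i) :
    ∃ M : Fin m, (2 / ((1 + Real.sqrt 13) / 3)) * B <
      ∑ i ∈ Finset.univ.filter (fun i => a i = M), s i := by
  obtain ⟨M, -, hM⟩ : ∃ M ∈ (Finset.univ : Finset (Fin m)),
      (1 : ℝ) < ∑ i ∈ Finset.univ.filter (fun i => a i = M), w i := by
    apply Finset.exists_lt_of_sum_lt
    rw [Finset.sum_fiberwise]
    simpa using htot
  have hsq : Real.sqrt 13 ^ 2 = 13 := Real.sq_sqrt (by norm_num)
  have hlo : 3.5 < Real.sqrt 13 := Real.lt_sqrt_of_sq_lt (by norm_num)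
  have hhi : Real.sqrt 13 < 4 := (Real.sqrt_lt' (by norm_num)).mpr (by norm_num)
  have hdiv : 2 / ((1 + Real.sqrt 13) / 3) = (Real.sqrt 13 - 1) / 2 := by
    rw [div_eq_iff (by positivity)]
    linarith
  refine ⟨M, lt_sum_size_of_one_lt_sum_weight _ w s ?_ ?_ ?_ ?_ hw hmed hbig hM⟩
  · exact mul_nonneg (by linarith) hB.le
  · exact mul_le_mul_of_nonneg_right (by linarith) hB.le
  · rw [hdiv, ← add_mul]
    exact mul_le_mul_of_nonneg_right (by linarith) hB.le
  · rw [hdiv, ← mul_assoc]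
    exact mul_le_mul_of_nonneg_right (by linarith) hB.le
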